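/- arXiv:2410.17861 — 2 statements merged into one kernel-verified Lean document; each statement's English description precedes it below -/
import Mathlib

section
/- Every finite subgroup H of the orthogonal group O(2) of 2×2 real orthogonal matrices is either cyclic or dihedral: either H is a cyclic group, or there exists k ≥ 1 such that H is isomorphic (as a group) to the dihedral group of order 2k. -/
/-- A group generated by `a` and an involution `s ∉ ⟨a⟩` inverting `a`, in which every element
lies in `⟨a⟩` or in `s⟨a⟩`, is dihedral. -/
theorem nonempty_mulEquiv_dihedralGroup {G : Type*} [Group G] (a s : G)
    (hs : s ∉ Subgroup.zpowers a) (hss : s * s = 1) (hsa : s * a * s = a⁻¹)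
    (hG : ∀ g : G, g ∈ Subgroup.zpowers a ∨ s * g ∈ Subgroup.zpowers a) :
    Nonempty (G ≃* DihedralGroup (orderOf a)) := by
  have hinv : s⁻¹ = s := inv_eq_of_mul_eq_one_left hss
  have hconj (k : ℤ) : a ^ k * s = s * a ^ (-k) := by
    have h : s * a ^ k * s⁻¹ = a ^ (-k) := by
      rw [← conj_zpow, hinv, hsa, inv_zpow, zpow_neg]
    rw [← h, hinv, ← mul_assoc, ← mul_assoc, hss, one_mul]
  have hker : zmultiplesHom (Additive G) (Additive.ofMul a) (orderOf a : ℤ) = 0 := by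
    simp [← ofMul_pow, pow_orderOf_eq_one]
  let ρ : ZMod (orderOf a) → G := fun i ↦
    (ZMod.lift (orderOf a) ⟨zmultiplesHom (Additive G) (Additive.ofMul a), hker⟩ i).toMul
  have hρ (k : ℤ) : ρ k = a ^ k := by simp [ρ]
  let f : DihedralGroup (orderOf a) →* G := MonoidHom.mk'
    (fun x ↦ match x with
      | .r i => ρ i
      | .sr i => s * ρ i) (by
    rintro (i | i) (j | j) <;> obtain ⟨i, rfl⟩ := ZMod.intCast_surjective i <;>
      obtain ⟨j, rfl⟩ := ZMod.intCast_surjective j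
    · simp only [DihedralGroup.r_mul_r, ← Int.cast_add, hρ, zpow_add]
    · simp only [DihedralGroup.r_mul_sr, ← Int.cast_sub, hρ]
      rw [← mul_assoc, hconj, mul_assoc, ← zpow_add, neg_add_eq_sub]
    · simp only [DihedralGroup.sr_mul_r, ← Int.cast_add, hρ, zpow_add, mul_assoc]
    · simp only [DihedralGroup.sr_mul_sr, ← Int.cast_sub, hρ]
      rw [mul_assoc, ← mul_assoc (a ^ i), hconj, mul_assoc, ← zpow_add, ← mul_assoc, hss,
        one_mul, neg_add_eq_sub])
  have hfr (k : ℤ) : f (.r k) = a ^ k := hρ k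
  have hfsr (k : ℤ) : f (.sr k) = s * a ^ k := congrArg (s * ·) (hρ k)
  refine ⟨(MulEquiv.ofBijective f ⟨(injective_iff_map_eq_one f).2 ?_, fun g ↦ ?_⟩).symm⟩
  · rintro (i | i) h <;> obtain ⟨i, rfl⟩ := ZMod.intCast_surjective i
    · rw [hfr, ← orderOf_dvd_iff_zpow_eq_one, ← ZMod.intCast_zmod_eq_zero_iff_dvd] at h
      rw [h, DihedralGroup.r_zero]
    · rw [hfsr] at h
      exact absurd ⟨-i, by simpa using (eq_inv_of_mul_eq_one_left h).symm⟩ hs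
  · rcases hG g with ⟨k, hk⟩ | ⟨k, hk⟩
    · exact ⟨.r k, (hfr k).trans hk⟩
    · refine ⟨.sr k, (hfsr k).trans ?_⟩
      change a ^ k = s * g at hk
      rw [hk, ← mul_assoc, hss, one_mul]

/-- A group with a cyclic subgroup `N` of index at most two all of whose non-members are
involutions is cyclic or dihedral. -/
theorem isCyclic_or_nonempty_mulEquiv_dihedralGroup {G : Type*} [Group G] [Finite G]
    (N : Subgroup G) [IsCyclic N] (hmul : ∀ g ∉ N, ∀ h ∉ N, g * h ∈ N)
    (hinv : ∀ g ∉ N, g * g = 1) :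
    IsCyclic G ∨ ∃ k : ℕ, 1 ≤ k ∧ Nonempty (G ≃* DihedralGroup k) := by
  obtain ⟨a, rfl⟩ := N.isCyclic_iff_exists_zpowers_eq_top.1 ‹_›
  by_cases htop : ∀ g, g ∈ Subgroup.zpowers a
  · exact .inl ⟨a, htop⟩
  · push Not at htop
    obtain ⟨s, hs⟩ := htop
    refine .inr ⟨orderOf a, orderOf_pos a, nonempty_mulEquiv_dihedralGroup a s hs (hinv s hs) ?_
      fun g ↦ or_iff_not_imp_left.2 (hmul s hs g)⟩
    refine eq_inv_of_mul_eq_one_left ?_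
    rw [mul_assoc]
    exact hinv _ fun h ↦ hs
      ((Subgroup.mul_mem_cancel_right _ (Subgroup.mem_zpowers a)).1 h)

namespace Matrix

theorem adjugate_eq_det_smul_transpose_of_mem_orthogonalGroup {n R : Type*} [Fintype n]
    [DecidableEq n] [CommRing R] {A : Matrix n n R} (hA : A ∈ orthogonalGroup n R) :
    A.adjugate = A.det • Aᵀ := by
  rw [← one_mul A.adjugate, ← (mem_orthogonalGroup_iff' n R).1 hA, mul_assoc, mul_adjugate,
    Matrix.mul_smul, mul_one]

theorem det_eq_one_or_neg_one_of_mem_orthogonalGroup {n R : Type*} [Fintype n] [DecidableEq n]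
    [CommRing R] [NoZeroDivisors R] {A : Matrix n n R} (hA : A ∈ orthogonalGroup n R) :
    A.det = 1 ∨ A.det = -1 := by
  have h := congrArg det ((mem_orthogonalGroup_iff n R).1 hA)
  rw [det_mul, det_transpose, det_one] at h
  exact mul_self_eq_one_iff.1 h

theorem apply_eq_of_mem_orthogonalGroup_of_det_eq_one {R : Type*} [CommRing R]
    {A : Matrix (Fin 2) (Fin 2) R} (hA : A ∈ orthogonalGroup (Fin 2) R) (hdet : A.det = 1) :
    A 1 1 = A 0 0 ∧ A 0 1 = -A 1 0 := by
  have h := adjugate_eq_det_smul_transpose_of_mem_orthogonalGroup hA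
  rw [adjugate_fin_two, hdet, one_smul] at h
  exact ⟨by simpa using congrFun₂ h 0 0, by simpa using (congrFun₂ h 1 0).symm⟩

theorem mul_self_eq_one_of_mem_orthogonalGroup_of_det_eq_neg_one {R : Type*} [CommRing R]
    {A : Matrix (Fin 2) (Fin 2) R} (hA : A ∈ orthogonalGroup (Fin 2) R) (hdet : A.det = -1) :
    A * A = 1 := by
  have h := adjugate_eq_det_smul_transpose_of_mem_orthogonalGroup hA
  rw [adjugate_fin_two, hdet] at h
  have h01 : A 0 1 = A 1 0 := by simpa using congrFun₂ h 0 1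
  have hsymm : Aᵀ = A := by
    ext i j
    fin_cases i <;> fin_cases j <;> simp [h01]
  simpa only [hsymm] using (mem_orthogonalGroup_iff (Fin 2) R).1 hA

end Matrix

open Matrix in
/-- Every finite subgroup of the orthogonal group `O(2)` is either cyclic or
isomorphic to a dihedral group of order `2k` for some `k ≥ 1`. -/
theorem finite_subgroup_O2_cyclic_or_dihedral
    (H : Subgroup (Matrix.orthogonalGroup (Fin 2) ℝ)) [Finite H] :
    IsCyclic H ∨ ∃ k : ℕ, 1 ≤ k ∧ Nonempty (H ≃* DihedralGroup k) := by
  let δ : H →* ℝ := (detMonoidHom.comp (Submonoid.subtype _)).comp H.subtype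
  have hδ (g : H) : δ g = (g : Matrix (Fin 2) (Fin 2) ℝ).det := rfl
  have hN (g : H) (hg : g ∉ δ.ker) : δ g = -1 :=
    (det_eq_one_or_neg_one_of_mem_orthogonalGroup g.1.2).resolve_left hg
  have hrot (g : δ.ker) := apply_eq_of_mem_orthogonalGroup_of_det_eq_one g.1.1.2 g.2
  let φ : δ.ker →* ℂ :=
    { toFun g := ⟨g.1.1.1 0 0, g.1.1.1 1 0⟩
      map_one' := by apply Complex.ext <;> simp
      map_mul' g h := by
        have h1 := hrot g
        apply Complex.ext <;> simp [Matrix.mul_apply, Fin.sum_univ_two, h1.1, h1.2] <;> ring }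
  have hφ : Function.Injective φ := fun g h hgh ↦ by
    have h0 : g.1.1.1 0 0 = h.1.1.1 0 0 := congrArg Complex.re hgh
    have h1 : g.1.1.1 1 0 = h.1.1.1 1 0 := congrArg Complex.im hgh
    have hg := hrot g
    have hh := hrot h
    apply Subtype.ext; apply Subtype.ext; apply Subtype.ext
    ext i j
    fin_cases i <;> fin_cases j <;> simp_all
  have : IsCyclic δ.ker := isCyclic_of_injective_ringHom φ hφ
  refine isCyclic_or_nonempty_mulEquiv_dihedralGroup δ.ker (fun g hg h hh ↦ ?_) fun g hg ↦ ?_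
  · rw [MonoidHom.mem_ker, map_mul, hN g hg, hN h hh]
    norm_num
  · exact Subtype.ext <| Subtype.ext <|
      mul_self_eq_one_of_mem_orthogonalGroup_of_det_eq_neg_one g.1.2 (hN g hg)
end

section
/- The Lagrange action functional is G-equivariant: let T > 0, let x : ℝ → (Fin n → ℝ^d) be differentiable and T-periodic, let g ∈ G, let ε ∈ {1, −1} and θ ∈ ℝ, and define the transformed loop y(t) := g · (x(ε t + θ)). Then, assuming the mass condition, ∫_0^T [K(y′(t)) + U(y(t))] dt = ∫_0^T [K(x′(t)) + U(x(t))] dt. -/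
/-- The Newtonian potential `U(x) = ∑_{i<j} m i * m j / ‖x i - x j‖`
(with the convention `1/0 = 0` at collisions). -/
noncomputable def newtonPotential (d n : ℕ) (m : Fin n → ℝ)
    (x : Fin n → EuclideanSpace ℝ (Fin d)) : ℝ :=
  ∑ p ∈ Finset.univ.filter (fun p : Fin n × Fin n => p.1 < p.2),
    m p.1 * m p.2 / ‖x p.1 - x p.2‖

/-- The kinetic energy `K(v) = (1/2) ∑ i, m i * ‖v i‖²`. -/
noncomputable def kineticEnergy (d n : ℕ) (m : Fin n → ℝ)
    (v : Fin n → EuclideanSpace ℝ (Fin d)) : ℝ :=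
  (1 / 2) * ∑ i, m i * ‖v i‖ ^ 2

/-- The potential as half of the sum over all ordered pairs. -/
theorem newtonPotential_eq_half_sum (d n : ℕ) (m : Fin n → ℝ)
    (x : Fin n → EuclideanSpace ℝ (Fin d)) :
    newtonPotential d n m x = (1 / 2) * ∑ p : Fin n × Fin n, m p.1 * m p.2 / ‖x p.1 - x p.2‖ := by
  have hswap : newtonPotential d n m x =
      ∑ p ∈ Finset.univ.filter (fun p : Fin n × Fin n => p.2 < p.1),
        m p.1 * m p.2 / ‖x p.1 - x p.2‖ := by
    unfold newtonPotential
    refine Finset.sum_equiv (Equiv.prodComm _ _) (by simp) fun p _ => ?_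
    simp [mul_comm (m p.1), norm_sub_rev (x p.1)]
  have hsplit : ∑ p : Fin n × Fin n, m p.1 * m p.2 / ‖x p.1 - x p.2‖ =
      newtonPotential d n m x +
      ∑ p ∈ Finset.univ.filter (fun p : Fin n × Fin n => p.2 < p.1),
        m p.1 * m p.2 / ‖x p.1 - x p.2‖ := by
    unfold newtonPotential
    rw [Finset.sum_filter, Finset.sum_filter, ← Finset.sum_add_distrib]
    refine Finset.sum_congr rfl fun p _ => ?_
    rcases lt_trichotomy p.1 p.2 with h | h | h
    · simp [h, h.not_gt]
    · simp [h]
    · simp [h, h.not_gt]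
  rw [hsplit, ← hswap]
  ring

/-- The potential is invariant under a linear isometry combined with a mass-preserving
permutation of the bodies. -/
theorem newtonPotential_isometry_perm (d n : ℕ) (m : Fin n → ℝ)
    (R : EuclideanSpace ℝ (Fin d) ≃ₗᵢ[ℝ] EuclideanSpace ℝ (Fin d)) (s : Equiv.Perm (Fin n))
    (hs : ∀ i, m (s i) = m i) (x : Fin n → EuclideanSpace ℝ (Fin d)) :
    newtonPotential d n m (fun i => R (x (s⁻¹ i))) = newtonPotential d n m x := by
  rw [newtonPotential_eq_half_sum, newtonPotential_eq_half_sum]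
  congr 1
  refine (Fintype.sum_equiv (Equiv.prodCongr s s) _ _ fun p => ?_).symm
  simp [hs, ← map_sub]

/-- The kinetic energy is invariant under a linear isometry combined with a mass-preserving
permutation of the bodies. -/
theorem kineticEnergy_isometry_perm (d n : ℕ) (m : Fin n → ℝ)
    (R : EuclideanSpace ℝ (Fin d) ≃ₗᵢ[ℝ] EuclideanSpace ℝ (Fin d)) (s : Equiv.Perm (Fin n))
    (hs : ∀ i, m (s i) = m i) (v : Fin n → EuclideanSpace ℝ (Fin d)) :
    kineticEnergy d n m (fun i => R (v (s⁻¹ i))) = kineticEnergy d n m v := by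
  unfold kineticEnergy
  congr 1
  refine (Fintype.sum_equiv s _ _ fun i => ?_).symm
  simp [hs]

/-- The kinetic energy is even and quadratic in the velocity. -/
theorem kineticEnergy_smul (d n : ℕ) (m : Fin n → ℝ) (c : ℝ)
    (v : Fin n → EuclideanSpace ℝ (Fin d)) :
    kineticEnergy d n m (c • v) = c ^ 2 * kineticEnergy d n m v := by
  simp only [kineticEnergy, Pi.smul_apply, norm_smul, mul_pow, Real.norm_eq_abs, sq_abs,
    Finset.mul_sum]
  exact Finset.sum_congr rfl fun i _ => by ring

/-- The integral of a periodic function over a period is unchanged by a time shift, possibly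
combined with a time reversal. -/
theorem Function.Periodic.intervalIntegral_comp_mul_add {f : ℝ → ℝ} {T : ℝ}
    (hf : Function.Periodic f T) {ε : ℝ} (hε : ε = 1 ∨ ε = -1) (θ : ℝ) :
    ∫ t in (0 : ℝ)..T, f (ε * t + θ) = ∫ t in (0 : ℝ)..T, f t := by
  rcases hε with rfl | rfl
  · simp only [one_mul, intervalIntegral.integral_comp_add_right]
    simpa [add_comm] using hf.intervalIntegral_add_eq θ 0
  · simp only [neg_one_mul, neg_add_eq_sub, intervalIntegral.integral_comp_sub_left]
    simpa using hf.intervalIntegral_add_eq (θ - T) 0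

/-- The Lagrange action functional is `G`-equivariant: for a differentiable
`T`-periodic loop `x`, `g ∈ G`, `ε ∈ {1, -1}` and a time shift `θ`, the
transformed loop `y t = g • (x (ε t + θ))` has the same action as `x`. -/
theorem action_functional_equivariant
    (d n : ℕ) (hn : 2 ≤ n) (m : Fin n → ℝ) (hm : ∀ i, 0 < m i)
    (G : Type*) [Group G] [Finite G]
    (ρ : G →* (EuclideanSpace ℝ (Fin d) ≃ₗᵢ[ℝ] EuclideanSpace ℝ (Fin d)))
    (σ : G →* Equiv.Perm (Fin n))
    (hmass : ∀ (g : G) (i : Fin n), m (σ g i) = m i)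
    (T : ℝ) (hT : 0 < T)
    (x : ℝ → (Fin n → EuclideanSpace ℝ (Fin d)))
    (hdiff : Differentiable ℝ x)
    (hper : ∀ t, x (t + T) = x t)
    (g : G) (ε : ℝ) (hε : ε = 1 ∨ ε = -1) (θ : ℝ)
    (y : ℝ → (Fin n → EuclideanSpace ℝ (Fin d)))
    (hy : ∀ t, y t = fun i => ρ g (x (ε * t + θ) ((σ g)⁻¹ i))) :
    ∫ t in (0:ℝ)..T, (kineticEnergy d n m (deriv y t) + newtonPotential d n m (y t)) =
      ∫ t in (0:ℝ)..T, (kineticEnergy d n m (deriv x t) + newtonPotential d n m (x t)) := by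
  have hderiv : ∀ t, deriv y t =
      ε • fun i => ρ g (deriv x (ε * t + θ) ((σ g)⁻¹ i)) := by
    intro t
    have hinner : HasDerivAt (fun s : ℝ => ε * s + θ) ε t := by
      simpa using ((hasDerivAt_id t).const_mul ε).add_const θ
    have hcomp := (hdiff (ε * t + θ)).hasDerivAt.scomp t hinner
    rw [funext hy]
    refine HasDerivAt.deriv (hasDerivAt_pi.2 fun i => ?_)
    have h := (ρ g).toContinuousLinearEquiv.hasFDerivAt.comp_hasDerivAt t
      (hasDerivAt_pi.1 hcomp ((σ g)⁻¹ i))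
    simpa [Function.comp_def] using h
  have hsq : ε ^ 2 = 1 := by rcases hε with rfl | rfl <;> norm_num
  have hperiodic : Function.Periodic
      (fun t => kineticEnergy d n m (deriv x t) + newtonPotential d n m (x t)) T := by
    intro t
    have hd : deriv x (t + T) = deriv x t := by
      rw [← deriv_comp_add_const, funext hper]
    simp only [hd, hper]
  rw [← hperiodic.intervalIntegral_comp_mul_add hε θ]
  refine intervalIntegral.integral_congr fun t _ => ?_
  simp only [hderiv, hy, kineticEnergy_smul, hsq, one_mul,
    kineticEnergy_isometry_perm d n m (ρ g) (σ g) (hmass g),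
    newtonPotential_isometry_perm d n m (ρ g) (σ g) (hmass g)]
end
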